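/- The element R ∈ D ⊗ D is a universal R-matrix for D: R is invertible, R·Δ(x)·R⁻¹ = τ(Δ(x)) for all x ∈ D (where τ : D⊗D → D⊗D swaps the tensor factors), and in D⊗D⊗D one has (Δ⊗id)(R) = R₁₃R₂₃ and (id⊗Δ)(R) = R₁₃R₁₂, where for R = Σ_i α_i⊗β_i one sets R₁₂ = Σ_i α_i⊗β_i⊗1, R₁₃ = Σ_i α_i⊗1⊗β_i, R₂₃ = Σ_i 1⊗α_i⊗β_i. -/

import Mathlib

open scoped TensorProduct
open Finset

noncomputable section

namespace LogHennings

/-- `q = exp(iπ/p)`. -/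
def qq (p : ℕ) : ℂ := Complex.exp ((Real.pi : ℂ) * Complex.I / (p : ℂ))

/-- `q^{1/2} = exp(iπ/(2p))`. -/
def qh (p : ℕ) : ℂ := Complex.exp ((Real.pi : ℂ) * Complex.I / (2 * (p : ℂ)))

/-- quantum integer `[m] = (q^m - q^{-m})/(q - q⁻¹)`. -/
def qnum (p m : ℕ) : ℂ := ((qq p) ^ m - (qq p)⁻¹ ^ m) / (qq p - (qq p)⁻¹)

/-- quantum factorial `[m]! = [m][m-1]⋯[1]`. -/
def qfac (p : ℕ) : ℕ → ℂ
  | 0 => 1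
  | m + 1 => qnum p (m + 1) * qfac p m

/-- Generators of the restricted quantum group `U`. -/
inductive UGen | E | F | K | Kinv

abbrev FU := FreeAlgebra ℂ UGen

def fE : FU := FreeAlgebra.ι ℂ UGen.E
def fF : FU := FreeAlgebra.ι ℂ UGen.F
def fK : FU := FreeAlgebra.ι ℂ UGen.K
def fKinv : FU := FreeAlgebra.ι ℂ UGen.Kinv

/-- Defining relations of the restricted quantum group `U`. -/
inductive URel (p : ℕ) : FU → FU → Prop
  | Epow : URel p (fE ^ p) 0
  | Fpow : URel p (fF ^ p) 0
  | Kpow : URel p (fK ^ (2 * p)) 1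
  | KKinv : URel p (fK * fKinv) 1
  | KinvK : URel p (fKinv * fK) 1
  | KE : URel p (fK * fE * fKinv) ((qq p) ^ 2 • fE)
  | KF : URel p (fK * fF * fKinv) (((qq p) ^ 2)⁻¹ • fF)
  | EF : URel p (fE * fF - fF * fE) ((qq p - (qq p)⁻¹)⁻¹ • (fK - fKinv))

/-- The restricted quantum group `U = \bar U_q(sl2)`. -/
abbrev Uq (p : ℕ) := RingQuot (URel p)

def UE (p : ℕ) : Uq p := RingQuot.mkAlgHom ℂ (URel p) fE
def UF (p : ℕ) : Uq p := RingQuot.mkAlgHom ℂ (URel p) fF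
def UK (p : ℕ) : Uq p := RingQuot.mkAlgHom ℂ (URel p) fK
def UKinv (p : ℕ) : Uq p := RingQuot.mkAlgHom ℂ (URel p) fKinv

/-- Generators of the braided extension `D`. -/
inductive DGen | e | phi | k | kinv

abbrev FD := FreeAlgebra ℂ DGen

def fe : FD := FreeAlgebra.ι ℂ DGen.e
def fphi : FD := FreeAlgebra.ι ℂ DGen.phi
def fk : FD := FreeAlgebra.ι ℂ DGen.k
def fkinv : FD := FreeAlgebra.ι ℂ DGen.kinv

/-- Defining relations of `D`. -/
inductive DRel (p : ℕ) : FD → FD → Prop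
  | epow : DRel p (fe ^ p) 0
  | phipow : DRel p (fphi ^ p) 0
  | kpow : DRel p (fk ^ (4 * p)) 1
  | kkinv : DRel p (fk * fkinv) 1
  | kinvk : DRel p (fkinv * fk) 1
  | ke : DRel p (fk * fe * fkinv) (qq p • fe)
  | kphi : DRel p (fk * fphi * fkinv) ((qq p)⁻¹ • fphi)
  | ephi : DRel p (fe * fphi - fphi * fe)
      ((qq p - (qq p)⁻¹)⁻¹ • (fk ^ 2 - fkinv ^ 2))

/-- The braided extension `D` of `U`. -/
abbrev Dq (p : ℕ) := RingQuot (DRel p)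

def De (p : ℕ) : Dq p := RingQuot.mkAlgHom ℂ (DRel p) fe
def Dphi (p : ℕ) : Dq p := RingQuot.mkAlgHom ℂ (DRel p) fphi
def Dk (p : ℕ) : Dq p := RingQuot.mkAlgHom ℂ (DRel p) fk
def Dkinv (p : ℕ) : Dq p := RingQuot.mkAlgHom ℂ (DRel p) fkinv

/-- The `R`-matrix of `D`. -/
def Rmat (p : ℕ) : Dq p ⊗[ℂ] Dq p :=
  ((4 * (p : ℂ))⁻¹) •
    ∑ m ∈ range p, ∑ n ∈ range (4 * p), ∑ j ∈ range (4 * p),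
      (((qq p - (qq p)⁻¹) ^ m / qfac p m) *
          (qh p) ^ ((m : ℤ) * ((m : ℤ) - 1) + 2 * (m : ℤ) * ((n : ℤ) - (j : ℤ))
            - (n : ℤ) * (j : ℤ))) •
        ((De p ^ m * Dk p ^ n) ⊗ₜ[ℂ] (Dphi p ^ m * Dk p ^ j))

/-- `R₂₁ = τ(R)`. -/
def R21 (p : ℕ) : Dq p ⊗[ℂ] Dq p := TensorProduct.comm ℂ (Dq p) (Dq p) (Rmat p)

/-- The monodromy `M = R₂₁ R`. -/
def Mmat (p : ℕ) : Dq p ⊗[ℂ] Dq p := R21 p * Rmat p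

/-- The ribbon element `r ∈ D`. -/
def rib (p : ℕ) : Dq p :=
  ((1 - Complex.I) / (2 * (Real.sqrt p : ℂ))) •
    ∑ m ∈ range p, ∑ j ∈ range (2 * p),
      (((qq p - (qq p)⁻¹) ^ m / qfac p m) *
          (qh p) ^ (-(m : ℤ) + 2 * (m : ℤ) * (j : ℤ) + ((j : ℤ) + (p : ℤ) + 1) ^ 2)) •
        (Dphi p ^ m * De p ^ m * Dk p ^ (2 * j))

/-- The Drinfeld element `u = Σ S(β_i) α_i` for `R = Σ α_i ⊗ β_i`,
depending on a choice of antipode `S`. -/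
def drinfeldU (p : ℕ) (S : Dq p →ₗ[ℂ] Dq p) : Dq p :=
  LinearMap.mul' ℂ (Dq p) (TensorProduct.map S LinearMap.id (R21 p))

/-- `Δ` takes the prescribed values on the generators of `U`. -/
def IsDeltaU (p : ℕ) (Δ : Uq p →ₐ[ℂ] Uq p ⊗[ℂ] Uq p) : Prop :=
  Δ (UE p) = 1 ⊗ₜ[ℂ] UE p + UE p ⊗ₜ[ℂ] UK p ∧
  Δ (UF p) = UKinv p ⊗ₜ[ℂ] UF p + UF p ⊗ₜ[ℂ] 1 ∧
  Δ (UK p) = UK p ⊗ₜ[ℂ] UK p ∧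
  Δ (UKinv p) = UKinv p ⊗ₜ[ℂ] UKinv p

/-- `ε` takes the prescribed values on the generators of `U`. -/
def IsCounitU (p : ℕ) (ε : Uq p →ₐ[ℂ] ℂ) : Prop :=
  ε (UE p) = 0 ∧ ε (UF p) = 0 ∧ ε (UK p) = 1 ∧ ε (UKinv p) = 1

/-- `S` is an algebra anti-homomorphism taking the prescribed values on the
generators of `U`. -/
def IsAntipodeU (p : ℕ) (S : Uq p →ₗ[ℂ] Uq p) : Prop :=
  S 1 = 1 ∧ (∀ x y, S (x * y) = S y * S x) ∧
  S (UE p) = -(UE p * UKinv p) ∧ S (UF p) = -(UK p * UF p) ∧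
  S (UK p) = UKinv p ∧ S (UKinv p) = UK p

/-- `Δ` takes the prescribed values on the generators of `D`. -/
def IsDeltaD (p : ℕ) (Δ : Dq p →ₐ[ℂ] Dq p ⊗[ℂ] Dq p) : Prop :=
  Δ (De p) = 1 ⊗ₜ[ℂ] De p + De p ⊗ₜ[ℂ] (Dk p ^ 2) ∧
  Δ (Dphi p) = (Dkinv p ^ 2) ⊗ₜ[ℂ] Dphi p + Dphi p ⊗ₜ[ℂ] 1 ∧
  Δ (Dk p) = Dk p ⊗ₜ[ℂ] Dk p ∧
  Δ (Dkinv p) = Dkinv p ⊗ₜ[ℂ] Dkinv p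

/-- `ε` takes the prescribed values on the generators of `D`. -/
def IsCounitD (p : ℕ) (ε : Dq p →ₐ[ℂ] ℂ) : Prop :=
  ε (De p) = 0 ∧ ε (Dphi p) = 0 ∧ ε (Dk p) = 1 ∧ ε (Dkinv p) = 1

/-- `S` is an algebra anti-homomorphism taking the prescribed values on the
generators of `D`. -/
def IsAntipodeD (p : ℕ) (S : Dq p →ₗ[ℂ] Dq p) : Prop :=
  S 1 = 1 ∧ (∀ x y, S (x * y) = S y * S x) ∧
  S (De p) = -(De p * Dkinv p ^ 2) ∧ S (Dphi p) = -(Dk p ^ 2 * Dphi p) ∧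
  S (Dk p) = Dkinv p ∧ S (Dkinv p) = Dk p

/-- `ι` takes the prescribed values `E ↦ e`, `F ↦ φ`, `K^{±1} ↦ k^{±2}`. -/
def IsIota (p : ℕ) (ι : Uq p →ₐ[ℂ] Dq p) : Prop :=
  ι (UE p) = De p ∧ ι (UF p) = Dphi p ∧ ι (UK p) = Dk p ^ 2 ∧
  ι (UKinv p) = Dkinv p ^ 2

/-- `μ` takes the prescribed values on the PBW basis of `U`. -/
def IsMu (p : ℕ) (μ : Uq p →ₗ[ℂ] ℂ) : Prop :=
  ∀ m n l : ℕ, m < p → n < p → l < 2 * p →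
    μ (UE p ^ m * UF p ^ n * UK p ^ l) =
      if m = p - 1 ∧ n = p - 1 ∧ l = p + 1 then
        -((Real.sqrt (2 / (p : ℝ)) : ℂ)) * (qfac p (p - 1)) ^ 2
      else 0

variable {A : Type*} [Ring A] [Algebra ℂ A]

/-- Coassociativity of a comultiplication. -/
def Coassoc (Δ : A →ₐ[ℂ] A ⊗[ℂ] A) : Prop :=
  ∀ x, TensorProduct.assoc ℂ A A A
      (TensorProduct.map Δ.toLinearMap LinearMap.id (Δ x)) =
    TensorProduct.map LinearMap.id Δ.toLinearMap (Δ x)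

/-- The counit axiom. -/
def CounitAxiom (Δ : A →ₐ[ℂ] A ⊗[ℂ] A) (ε : A →ₐ[ℂ] ℂ) : Prop :=
  (∀ x, TensorProduct.lid ℂ A
      (TensorProduct.map ε.toLinearMap LinearMap.id (Δ x)) = x) ∧
  (∀ x, TensorProduct.rid ℂ A
      (TensorProduct.map LinearMap.id ε.toLinearMap (Δ x)) = x)

/-- The antipode axiom. -/
def AntipodeAxiom (Δ : A →ₐ[ℂ] A ⊗[ℂ] A) (ε : A →ₐ[ℂ] ℂ)
    (S : A →ₗ[ℂ] A) : Prop :=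
  (∀ x, LinearMap.mul' ℂ A (TensorProduct.map S LinearMap.id (Δ x)) = ε x • 1) ∧
  (∀ x, LinearMap.mul' ℂ A (TensorProduct.map LinearMap.id S (Δ x)) = ε x • 1)

/-- `x ↦ x ⊗ 1`. -/
def e1 (p : ℕ) : Dq p →ₗ[ℂ] Dq p ⊗[ℂ] Dq p :=
  (TensorProduct.mk ℂ (Dq p) (Dq p)).flip 1

/-- `x ↦ 1 ⊗ x`. -/
def e2 (p : ℕ) : Dq p →ₗ[ℂ] Dq p ⊗[ℂ] Dq p :=
  TensorProduct.mk ℂ (Dq p) (Dq p) 1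

/-- The balancing element `g = K^{p+1}`. -/
def gU (p : ℕ) : Uq p := UK p ^ (p + 1)

/-- The span of commutators `[U,U]`. -/
def commSpan (p : ℕ) : Submodule ℂ (Uq p) :=
  Submodule.span ℂ {z : Uq p | ∃ x y : Uq p, z = x * y - y * x}

end LogHennings

namespace LogHennings

section general

variable {B : Type*} [Semiring B] [Algebra ℂ B]

lemma qh_prim (p : ℕ) (hp : 2 ≤ p) : IsPrimitiveRoot (qh p) (4 * p) := by
  have h := Complex.isPrimitiveRoot_exp (4 * p) (by omega)
  have hp0 : (p : ℂ) ≠ 0 := by exact_mod_cast (by omega : p ≠ 0)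
  have : qh p = Complex.exp (2 * (Real.pi : ℂ) * Complex.I / ((4 * p : ℕ) : ℂ)) := by
    unfold qh
    congr 1
    push_cast
    field_simp
    ring
  rw [this]; exact h

lemma qh_ne (p : ℕ) : qh p ≠ 0 := Complex.exp_ne_zero _

lemma qq_ne (p : ℕ) : qq p ≠ 0 := Complex.exp_ne_zero _

lemma qq_eq (p : ℕ) (hp : 2 ≤ p) : qq p = qh p ^ 2 := by
  have hp0 : (p : ℂ) ≠ 0 := by exact_mod_cast (by omega : p ≠ 0)
  unfold qq qh
  rw [← Complex.exp_nat_mul]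
  congr 1
  push_cast
  field_simp

/-- Fourier projector. -/
def Pj (p : ℕ) (y : B) (n : ℕ) : B :=
  ((4 * (p : ℂ))⁻¹) • ∑ j ∈ range (4 * p), (qh p) ^ (-((n : ℤ) * (j : ℤ))) • y ^ j

/-- The Cartan part. -/
def Th (p : ℕ) (x y : B) : B :=
  ((4 * (p : ℂ))⁻¹) • ∑ n ∈ range (4 * p), ∑ j ∈ range (4 * p),
    (qh p) ^ (-((n : ℤ) * (j : ℤ))) • (x ^ n * y ^ j)

lemma Th_eq (p : ℕ) (x y : B) : Th p x y = ∑ n ∈ range (4 * p), x ^ n * Pj p y n := by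
  simp only [Th, Pj, smul_sum, mul_sum, mul_smul_comm]

lemma Th_symm (p : ℕ) (x y : B) (h : Commute x y) : Th p x y = Th p y x := by
  simp only [Th]
  rw [sum_comm]
  congr 1
  refine sum_congr rfl fun n _ => sum_congr rfl fun j _ => ?_
  rw [mul_comm (j : ℤ), (h.pow_pow j n).eq]

lemma ortho (p : ℕ) (hp : 2 ≤ p) (m n : ℕ) (hm : m < 4 * p) (hn : n < 4 * p) :
    (4 * (p : ℂ))⁻¹ * ∑ j ∈ range (4 * p),
      (qh p) ^ (-((m : ℤ) * (j : ℤ))) * (qh p) ^ (n * j) = if m = n then 1 else 0 := by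
  have hp0 : (p : ℂ) ≠ 0 := by exact_mod_cast (by omega : p ≠ 0)
  have hz := qh_ne p
  have hterm : ∀ j : ℕ, (qh p) ^ (-((m : ℤ) * (j : ℤ))) * (qh p) ^ (n * j)
      = ((qh p) ^ ((n : ℤ) - (m : ℤ))) ^ j := by
    intro j
    rw [← zpow_natCast, ← zpow_natCast, ← zpow_mul, ← zpow_add₀ hz]
    congr 1
    push_cast
    ring
  simp only [hterm]
  split_ifs with h
  · subst h
    simp
    field_simp
  · have hne : (qh p) ^ ((n : ℤ) - (m : ℤ)) ≠ 1 := by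
      intro h1
      rw [(qh_prim p hp).zpow_eq_one_iff_dvd] at h1
      obtain ⟨c, hc⟩ := h1
      have hc0 : c = 0 := by
        push_cast at hc
        have h1 : c < 1 := by nlinarith
        have h2 : -1 < c := by nlinarith
        omega
      subst hc0
      omega
    rw [geom_sum_eq hne]
    have : ((qh p) ^ ((n : ℤ) - (m : ℤ))) ^ (4 * p) = 1 := by
      rw [← zpow_natCast, ← zpow_mul, mul_comm, zpow_mul, zpow_natCast,
        (qh_prim p hp).pow_eq_one, one_zpow]
    rw [this]; simp

lemma cancel_aux (a b c : B) (h : a + c = b + c) : a = b := by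
  have h0 : c + (-1 : ℂ) • c = 0 := by
    conv_lhs => rw [← one_smul ℂ c, smul_smul, ← add_smul]
    simp
  have h1 := congrArg (fun x => x + (-1 : ℂ) • c) h
  simpa only [add_assoc, h0, add_zero] using h1

lemma mul_Pj (p : ℕ) (hp : 2 ≤ p) (y : B) (hy : y ^ (4 * p) = 1) (n : ℕ) :
    y * Pj p y n = (qh p) ^ n • Pj p y n := by
  have hz := qh_ne p
  have hzN := (qh_prim p hp).pow_eq_one
  unfold Pj
  rw [mul_smul_comm, smul_comm]
  congr 1
  rw [mul_sum, smul_sum]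
  set f : ℕ → B := fun j => (qh p) ^ n • (qh p) ^ (-((n : ℤ) * (j : ℤ))) • y ^ j with hf
  have h1 : ∀ j : ℕ, y * (qh p) ^ (-((n : ℤ) * (j : ℤ))) • y ^ j = f (j + 1) := by
    intro j
    simp only [hf, mul_smul_comm, smul_smul, ← pow_succ']
    congr 1
    rw [← zpow_natCast, ← zpow_add₀ hz]
    congr 1
    push_cast
    ring
  simp only [h1]
  have h2 : f (4 * p) = f 0 := by
    simp only [hf, hy, pow_zero]
    congr 2
    rw [Nat.cast_zero, mul_zero, neg_zero, zpow_zero, zpow_neg, mul_comm, zpow_mul,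
      zpow_natCast (qh p) (4 * p), hzN, one_zpow, inv_one]
  have h3 := sum_range_succ f (4 * p)
  have h4 := sum_range_succ' f (4 * p)
  rw [h3, h2] at h4
  exact (cancel_aux _ _ _ h4).symm

lemma pow_mul_Pj (p : ℕ) (hp : 2 ≤ p) (y : B) (hy : y ^ (4 * p) = 1) (n s : ℕ) :
    y ^ s * Pj p y n = (qh p) ^ (n * s) • Pj p y n := by
  induction s with
  | zero => simp
  | succ s ih =>
    rw [pow_succ', mul_assoc, ih, mul_smul_comm, mul_Pj p hp y hy, smul_smul, ← pow_add,
      Nat.mul_succ]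

lemma Pj_mul (p : ℕ) (hp : 2 ≤ p) (y : B) (hy : y ^ (4 * p) = 1) (m n : ℕ)
    (hm : m < 4 * p) (hn : n < 4 * p) :
    Pj p y m * Pj p y n = if m = n then Pj p y n else 0 := by
  have : Pj p y m * Pj p y n = ((4 * (p : ℂ))⁻¹ * ∑ j ∈ range (4 * p),
      (qh p) ^ (-((m : ℤ) * (j : ℤ))) * (qh p) ^ (n * j)) • Pj p y n := by
    conv_lhs => rw [Pj]
    rw [smul_mul_assoc, sum_mul, mul_smul, sum_smul]
    congr 1
    refine sum_congr rfl fun j _ => ?_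
    rw [smul_mul_assoc, pow_mul_Pj p hp y hy, smul_smul]
  rw [this, ortho p hp m n hm hn]
  split_ifs <;> simp

lemma sum_Pj (p : ℕ) (hp : 2 ≤ p) (y : B) : ∑ n ∈ range (4 * p), Pj p y n = 1 := by
  simp only [Pj]
  rw [← smul_sum, sum_comm, smul_sum]
  simp only [← sum_smul, smul_smul]
  have : ∀ j ∈ range (4 * p), ((4 * (p : ℂ))⁻¹ * ∑ n ∈ range (4 * p),
      (qh p) ^ (-((n : ℤ) * (j : ℤ)))) • y ^ j = if j = 0 then (1 : B) else 0 := by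
    intro j hj
    have h := ortho p hp j 0 (by simpa using hj) (by omega)
    simp only [zero_mul, pow_zero, mul_one] at h
    simp only [mul_comm _ (j : ℤ)]
    rw [h]
    split_ifs with h0 <;> simp [h0]
  rw [sum_congr rfl this]
  simp [show p ≠ 0 by omega]

lemma Pj_commute (p : ℕ) (x y : B) (h : Commute x y) (n : ℕ) : Commute x (Pj p y n) := by
  unfold Pj
  refine Commute.smul_right (Commute.sum_right _ _ _ fun j _ => ?_) _
  exact (h.pow_right j).smul_right _

lemma Th_commute (p : ℕ) (w x y : B) (h1 : Commute w x) (h2 : Commute w y) :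
    Commute w (Th p x y) := by
  rw [Th_eq]
  exact Commute.sum_right _ _ _ fun n _ => (h1.pow_right n).mul_right (Pj_commute p w y h2 n)

lemma Th_mul (p : ℕ) (hp : 2 ≤ p) (x x' y : B) (hy : y ^ (4 * p) = 1)
    (hxx : Commute x x') (h' : Commute x' y) :
    Th p (x * x') y = Th p x y * Th p x' y := by
  simp only [Th_eq]
  rw [sum_mul_sum]
  refine sum_congr rfl fun n hn => ?_
  have : ∀ m ∈ range (4 * p), x ^ n * Pj p y n * (x' ^ m * Pj p y m) =
      if n = m then (x * x') ^ n * Pj p y n else 0 := by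
    intro m hm
    rw [mul_assoc, ← mul_assoc (Pj p y n), ← ((Pj_commute p x' y h' n).pow_left m).eq,
      mul_assoc, Pj_mul p hp y hy n m (by simpa using hn) (by simpa using hm)]
    split_ifs with h
    · subst h
      rw [hxx.mul_pow, mul_assoc]
    · simp
  rw [sum_congr rfl this]
  simp [hn]

lemma Th_mul_right (p : ℕ) (hp : 2 ≤ p) (x y y' : B) (hx : x ^ (4 * p) = 1)
    (hyy : Commute y y') (h : Commute x y) (h' : Commute x y') :
    Th p x (y * y') = Th p x y * Th p x y' := by
  rw [Th_symm p x _ (h.mul_right h'), Th_mul p hp y y' x hx hyy h'.symm,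
    Th_symm p x y h, Th_symm p x y' h']

lemma Th_one (p : ℕ) (hp : 2 ≤ p) (y : B) : Th p 1 y = 1 := by
  rw [Th_eq]; simp [sum_Pj p hp y]

lemma Th_unit (p : ℕ) (hp : 2 ≤ p) (x x' y : B) (hy : y ^ (4 * p) = 1)
    (h1 : x * x' = 1) (h2 : x' * x = 1) (h : Commute x y) (h' : Commute x' y) :
    IsUnit (Th p x y) := by
  refine ⟨⟨Th p x y, Th p x' y, ?_, ?_⟩, rfl⟩
  · rw [← Th_mul p hp x x' y hy (h1.trans h2.symm) h', h1, Th_one p hp]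
  · rw [← Th_mul p hp x' x y hy (h2.trans h1.symm) h, h2, Th_one p hp]

/-- moving an element through the Cartan part -/
lemma Th_move (p : ℕ) (hp : 2 ≤ p) (x y X : B) (s : ℕ) (hy : y ^ (4 * p) = 1)
    (hxy : Commute x y)
    (h1 : x * X = (qh p) ^ s • (X * x)) (h2 : Commute X y) :
    Th p x y * X = X * y ^ s * Th p x y := by
  have hpow : ∀ n : ℕ, x ^ n * X = (qh p) ^ (n * s) • (X * x ^ n) := by
    intro n
    induction n with
    | zero => simp
    | succ n ih =>
      rw [pow_succ', mul_assoc, ih, mul_smul_comm, ← mul_assoc, h1, smul_mul_assoc, smul_smul,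
        mul_assoc, Nat.succ_mul, pow_add]
  rw [Th_eq, sum_mul, mul_sum]
  refine sum_congr rfl fun n _ => ?_
  rw [mul_assoc, ← (Pj_commute p X y h2 n).eq, ← mul_assoc, hpow, smul_mul_assoc,
    mul_assoc, mul_assoc, ← mul_assoc (y ^ s), ← (hxy.pow_pow n s).eq, mul_assoc (x ^ n),
    pow_mul_Pj p hp y hy, mul_smul_comm, mul_smul_comm]

lemma Th_move_right (p : ℕ) (hp : 2 ≤ p) (x y X : B) (s : ℕ) (hx : x ^ (4 * p) = 1)
    (hxy : Commute x y)
    (h1 : y * X = (qh p) ^ s • (X * y)) (h2 : Commute X x) :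
    Th p x y * X = X * x ^ s * Th p x y := by
  rw [Th_symm p x y hxy]
  exact Th_move p hp y x X s hx hxy.symm h1 h2

/-- coefficients -/
def aco (p m : ℕ) : ℂ := ((qq p - (qq p)⁻¹) ^ m / qfac p m) * (qh p) ^ ((m : ℤ) * ((m : ℤ) - 1))

/-- `r`-number with `r = q⁻²`. -/
def rn (p m : ℕ) : ℂ := ∑ i ∈ range m, ((qq p)⁻¹ ^ 2) ^ i

/-- q-exponential -/
def Ex (p : ℕ) (X : B) : B := ∑ m ∈ range p, aco p m • X ^ m

lemma aco_zero (p : ℕ) : aco p 0 = 1 := by simp [aco, qfac]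

lemma lam_ne (p : ℕ) (hp : 2 ≤ p) : qq p - (qq p)⁻¹ ≠ 0 := by
  intro h
  have hq := qq_ne p
  have h1 : qq p ^ 2 = 1 := by
    field_simp at h
    linear_combination h
  rw [qq_eq p hp, ← pow_mul] at h1
  have := (qh_prim p hp).dvd_of_pow_eq_one _ h1
  have := Nat.le_of_dvd (by omega) this
  omega

lemma qnum_ne (p : ℕ) (hp : 2 ≤ p) (m : ℕ) (h0 : 0 < m) (hm : m < p) : qnum p m ≠ 0 := by
  unfold qnum
  refine div_ne_zero ?_ (lam_ne p hp)
  intro h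
  have hq := qq_ne p
  have h1 : qq p ^ (2 * m) = 1 := by
    rw [inv_pow] at h
    have : qq p ^ m ≠ 0 := pow_ne_zero _ hq
    field_simp at h
    rw [mul_comm, pow_mul]
    linear_combination h
  rw [qq_eq p hp, ← pow_mul] at h1
  have := (qh_prim p hp).dvd_of_pow_eq_one _ h1
  have := Nat.le_of_dvd (by omega) this
  omega

lemma qnum_eq (p : ℕ) (hp : 2 ≤ p) (m : ℕ) : qnum p (m + 1) = qq p ^ m * rn p (m + 1) := by
  have hl := lam_ne p hp
  have hq := qq_ne p
  have hr : (qq p)⁻¹ ^ 2 ≠ 1 := by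
    intro h
    apply hl
    have : (qq p) * (qq p)⁻¹ = 1 := mul_inv_cancel₀ hq
    linear_combination (-qq p) * h + (qq p)⁻¹ * this
  have hg := geom_sum_eq hr (m + 1)
  unfold rn qnum
  rw [div_eq_iff hl, hg]
  have hr' := sub_ne_zero.mpr hr
  rw [mul_div_assoc', div_mul_eq_mul_div, eq_div_iff hr']
  have e1 : ((qq p)⁻¹ ^ 2) ^ (m + 1) = ((qq p)⁻¹ ^ (m + 1)) ^ 2 := by
    rw [← pow_mul, ← pow_mul, mul_comm]
  rw [e1]
  have e2 : qq p ^ (m + 1) * (qq p)⁻¹ ^ (m + 1) = 1 := by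
    rw [← mul_pow, mul_inv_cancel₀ hq, one_pow]
  have e3 : (qq p) * (qq p)⁻¹ = 1 := mul_inv_cancel₀ hq
  have e4 : qq p ^ m = qq p ^ (m + 1) * (qq p)⁻¹ := by
    rw [pow_succ, mul_assoc, e3, mul_one]
  rw [e4]
  generalize qq p ^ (m + 1) = a at *
  generalize (qq p)⁻¹ ^ (m + 1) = b at *
  generalize (qq p)⁻¹ = c at *
  linear_combination (-a * b ^ 2 + a) * e3 - b * (1 - c ^ 2) * e2 + 0 * e3

lemma aco_succ (p : ℕ) (hp : 2 ≤ p) (m : ℕ) (hm : m + 1 < p) :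
    rn p (m + 1) * aco p (m + 1) = (qq p - (qq p)⁻¹) * aco p m := by
  have hn := qnum_ne p hp (m + 1) (by omega) hm
  have hq := qq_ne p
  have hz := qh_ne p
  have hrn : rn p (m + 1) ≠ 0 := by
    intro h; rw [qnum_eq p hp, h] at hn; simp at hn
  have hf : qfac p m ≠ 0 := by
    have : ∀ n, n < p → qfac p n ≠ 0 := by
      intro n
      induction n with
      | zero => simp [qfac]
      | succ n ih => exact fun h => mul_ne_zero (qnum_ne p hp _ (by omega) h) (ih (by omega))
    exact this m (by omega)
  have hexp : (qh p) ^ (((m + 1 : ℕ) : ℤ) * (((m + 1 : ℕ) : ℤ) - 1)) =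
      qq p ^ m * (qh p) ^ ((m : ℤ) * ((m : ℤ) - 1)) := by
    rw [qq_eq p hp, ← pow_mul, ← zpow_natCast, ← zpow_add₀ hz]
    congr 1
    push_cast
    ring
  unfold aco
  rw [hexp, qfac, qnum_eq p hp, pow_succ]
  generalize qq p - (qq p)⁻¹ = l
  field_simp

lemma rn_add (p i j : ℕ) : rn p (i + j) = rn p i + ((qq p)⁻¹ ^ 2) ^ i * rn p j := by
  unfold rn
  rw [sum_range_add, mul_sum]
  simp only [pow_add]

lemma rn_ne (p : ℕ) (hp : 2 ≤ p) (m : ℕ) (hm : m + 1 < p) : rn p (m + 1) ≠ 0 := by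
  have hn := qnum_ne p hp (m + 1) (by omega) hm
  intro h; rw [qnum_eq p hp, h] at hn; simp at hn

lemma rn_zero (p : ℕ) : rn p 0 = 0 := by simp [rn]

lemma rn_one (p : ℕ) : rn p 1 = 1 := by simp [rn]

lemma Ex_aux (p : ℕ) (hp : 2 ≤ p) (X Y : B) (h : X * Y = ((qq p)⁻¹ ^ 2) • (Y * X)) (n : ℕ)
    (hn : n < p) : aco p n • (X + Y) ^ n =
      ∑ ij ∈ antidiagonal n, (aco p ij.1 * aco p ij.2) • (Y ^ ij.1 * X ^ ij.2) := by
  have hpow : ∀ i : ℕ, X * Y ^ i = (((qq p)⁻¹ ^ 2) ^ i) • (Y ^ i * X) := by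
    intro i
    induction i with
    | zero => simp
    | succ i ih =>
      rw [pow_succ Y, ← mul_assoc, ih, smul_mul_assoc, mul_assoc, h, mul_smul_comm, smul_smul,
        mul_assoc, pow_succ _ i]
  induction n with
  | zero => simp [aco_zero]
  | succ n ih =>
    have ih := ih (by omega)
    have hr := rn_ne p hp n hn
    have e1 : rn p (n + 1) • aco p (n + 1) • (X + Y) ^ (n + 1) =
        (qq p - (qq p)⁻¹) • ((X + Y) * (aco p n • (X + Y) ^ n)) := by
      rw [smul_smul, aco_succ p hp n hn, pow_succ', mul_smul_comm, smul_smul]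
    have e2 : rn p (n + 1) • ∑ ij ∈ antidiagonal (n + 1),
        (aco p ij.1 * aco p ij.2) • (Y ^ ij.1 * X ^ ij.2) =
        (∑ ij ∈ antidiagonal (n + 1),
          (rn p ij.1 * aco p ij.1 * aco p ij.2) • (Y ^ ij.1 * X ^ ij.2)) +
        ∑ ij ∈ antidiagonal (n + 1),
          (((qq p)⁻¹ ^ 2) ^ ij.1 * aco p ij.1 * (rn p ij.2 * aco p ij.2)) •
            (Y ^ ij.1 * X ^ ij.2) := by
      rw [smul_sum, ← sum_add_distrib]
      refine sum_congr rfl fun ij hij => ?_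
      rw [HasAntidiagonal.mem_antidiagonal] at hij
      rw [← hij, rn_add, smul_smul, ← add_smul]
      congr 1
      ring
    have e3 : (∑ ij ∈ antidiagonal (n + 1),
          (rn p ij.1 * aco p ij.1 * aco p ij.2) • (Y ^ ij.1 * X ^ ij.2)) =
        (qq p - (qq p)⁻¹) • (Y * ∑ ij ∈ antidiagonal n,
          (aco p ij.1 * aco p ij.2) • (Y ^ ij.1 * X ^ ij.2)) := by
      rw [Nat.sum_antidiagonal_succ, rn_zero, zero_mul, zero_mul, zero_smul, zero_add,
        mul_sum, smul_sum]
      refine sum_congr rfl fun ij hij => ?_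
      rw [HasAntidiagonal.mem_antidiagonal] at hij
      rw [aco_succ p hp _ (by omega), mul_smul_comm, smul_smul, pow_succ', mul_assoc, mul_assoc]
    have e4 : (∑ ij ∈ antidiagonal (n + 1),
          (((qq p)⁻¹ ^ 2) ^ ij.1 * aco p ij.1 * (rn p ij.2 * aco p ij.2)) •
            (Y ^ ij.1 * X ^ ij.2)) =
        (qq p - (qq p)⁻¹) • (X * ∑ ij ∈ antidiagonal n,
          (aco p ij.1 * aco p ij.2) • (Y ^ ij.1 * X ^ ij.2)) := by
      rw [Nat.sum_antidiagonal_succ', rn_zero, zero_mul, mul_zero, zero_smul, zero_add,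
        mul_sum, smul_sum]
      refine sum_congr rfl fun ij hij => ?_
      rw [HasAntidiagonal.mem_antidiagonal] at hij
      rw [aco_succ p hp _ (by omega), mul_smul_comm, smul_smul, ← mul_assoc X, hpow,
        smul_mul_assoc, smul_smul, mul_assoc (Y ^ _), ← pow_succ']
      congr 1
      ring
    have e5 := e1
    rw [ih, add_mul, smul_add, ← e3, ← e4, add_comm (∑ ij ∈ _, _), ← e2] at e5
    have := congrArg (fun w => (rn p (n + 1))⁻¹ • w) e5
    simpa [smul_smul, inv_mul_cancel₀ hr, ← mul_assoc] using this

lemma Ex_add (p : ℕ) (hp : 2 ≤ p) (X Y : B) (h : X * Y = ((qq p)⁻¹ ^ 2) • (Y * X))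
    (h0 : ∀ i j : ℕ, p ≤ i + j → Y ^ i * X ^ j = 0) : Ex p (X + Y) = Ex p Y * Ex p X := by
  unfold Ex
  rw [sum_congr rfl fun n hn => Ex_aux p hp X Y h n (mem_range.mp hn)]
  simp only [Nat.sum_antidiagonal_eq_sum_range_succ
    (fun i j => (aco p i * aco p j) • (Y ^ i * X ^ j))]
  rw [sum_range_diag_flip p (fun i j => (aco p i * aco p j) • (Y ^ i * X ^ j)), sum_mul_sum]
  refine sum_congr rfl fun i _ => ?_
  simp only [smul_mul_smul_comm]
  refine sum_subset (by intro j; simp; omega) fun j _ hj => ?_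
  rw [h0 i j (by simp at hj; omega), smul_zero]

lemma comm_pow {B : Type*} [Ring B] [Algebra ℂ B] (p : ℕ) (W E U V : B)
    (hWE : W * E - E * W = (qq p - (qq p)⁻¹)⁻¹ • (U - V))
    (hUE : U * E = ((qq p)⁻¹ ^ 2) • (E * U)) (hEV : E * V = ((qq p)⁻¹ ^ 2) • (V * E)) (m : ℕ) :
    W * E ^ (m + 1) - E ^ (m + 1) * W =
      (rn p (m + 1) * (qq p - (qq p)⁻¹)⁻¹) • (E ^ m * U - V * E ^ m) := by
  have hpow : ∀ i : ℕ, E ^ i * V = (((qq p)⁻¹ ^ 2) ^ i) • (V * E ^ i) := by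
    intro i
    induction i with
    | zero => simp
    | succ i ih =>
      rw [pow_succ' E, mul_assoc, ih, mul_smul_comm, ← mul_assoc, hEV, smul_mul_assoc, smul_smul,
        mul_assoc, ← pow_succ (_ ^ 2) i]
  induction m with
  | zero => simpa [rn_one] using hWE
  | succ m ih =>
    have e1 : W * E ^ (m + 1 + 1) - E ^ (m + 1 + 1) * W =
        (W * E ^ (m + 1) - E ^ (m + 1) * W) * E + E ^ (m + 1) * (W * E - E * W) := by
      rw [pow_succ E (m + 1)]
      noncomm_ring
    have e2 : E ^ m * U * E = ((qq p)⁻¹ ^ 2) • (E ^ (m + 1) * U) := by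
      rw [mul_assoc, hUE, mul_smul_comm, pow_succ E, mul_assoc]
    have e3 : V * E ^ m * E = V * E ^ (m + 1) := by rw [mul_assoc, pow_succ]
    have r1 : rn p (m + 1 + 1) = 1 + ((qq p)⁻¹ ^ 2) * rn p (m + 1) := by
      rw [add_comm (m + 1) 1, rn_add, rn_one, pow_one]
    have r2 : rn p (m + 1 + 1) = rn p (m + 1) + ((qq p)⁻¹ ^ 2) ^ (m + 1) := by
      rw [rn_add, rn_one, mul_one]
    rw [e1, ih, hWE, smul_mul_assoc, sub_mul, e2, e3, mul_smul_comm, mul_sub, hpow, smul_sub,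
      smul_sub, smul_sub]
    nth_rewrite 1 [r1]
    rw [r2]
    module

lemma Ex_comm {B : Type*} [Ring B] [Algebra ℂ B] (p : ℕ) (hp : 2 ≤ p) (W E U V : B)
    (hWE : W * E - E * W = (qq p - (qq p)⁻¹)⁻¹ • (U - V))
    (hUE : U * E = ((qq p)⁻¹ ^ 2) • (E * U)) (hEV : E * V = ((qq p)⁻¹ ^ 2) • (V * E))
    (h1 : E ^ (p - 1) * U = 0) (h2 : V * E ^ (p - 1) = 0) :
    Ex p E * (W + U) = (V + W) * Ex p E := by
  have hl := lam_ne p hp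
  have key : W * Ex p E - Ex p E * W = Ex p E * U - V * Ex p E := by
    have hLL : W * Ex p E - Ex p E * W = ∑ m ∈ range p, aco p m • (W * E ^ m - E ^ m * W) := by
      unfold Ex
      rw [mul_sum, sum_mul, ← sum_sub_distrib]
      refine sum_congr rfl fun m _ => ?_
      rw [mul_smul_comm, smul_mul_assoc, smul_sub]
    have hRR : Ex p E * U - V * Ex p E = ∑ m ∈ range p, aco p m • (E ^ m * U - V * E ^ m) := by
      unfold Ex
      rw [mul_sum, sum_mul, ← sum_sub_distrib]
      refine sum_congr rfl fun m _ => ?_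
      rw [mul_smul_comm, smul_mul_assoc, smul_sub]
    rw [hLL, hRR]
    obtain ⟨s, rfl⟩ : ∃ s, p = s + 1 := ⟨p - 1, by omega⟩
    simp only [Nat.add_sub_cancel] at h1 h2
    rw [sum_range_succ', sum_range_succ, h1, h2]
    simp only [pow_zero, mul_one, one_mul, sub_self, smul_zero, add_zero]
    refine sum_congr rfl fun m hm => ?_
    rw [mem_range] at hm
    rw [comm_pow (s + 1) W E U V hWE hUE hEV, smul_smul]
    congr 1
    rw [← mul_assoc, mul_comm (aco _ _), aco_succ (s + 1) hp m (by omega)]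
    rw [mul_right_comm, mul_inv_cancel₀ hl, one_mul]
  rw [mul_add, add_mul]
  rw [sub_eq_sub_iff_add_eq_add] at key
  rw [← add_comm (W * Ex p E), key, add_comm]

lemma Ex_unit {B : Type*} [Ring B] [Algebra ℂ B] (p : ℕ) (hp : 2 ≤ p) (X : B) (hX : X ^ p = 0) : IsUnit (Ex p X) := by
  obtain ⟨s, rfl⟩ : ∃ s, p = s + 1 := ⟨p - 1, by omega⟩
  have : Ex (s + 1) X = 1 + X * ∑ m ∈ range s, aco (s + 1) (m + 1) • X ^ m := by
    unfold Ex
    rw [sum_range_succ', pow_zero, aco_zero, one_smul, add_comm, mul_sum]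
    congr 1
    refine sum_congr rfl fun m _ => ?_
    rw [mul_smul_comm, pow_succ']
  rw [this]
  apply IsNilpotent.isUnit_one_add
  refine Commute.isNilpotent_mul_right ?_ ⟨_, hX⟩
  exact Commute.sum_right _ _ _ fun m _ => ((Commute.refl X).pow_right m).smul_right _

lemma Ex_commute (p : ℕ) (w X : B) (h : Commute w X) : Commute w (Ex p X) :=
  Commute.sum_right _ _ _ fun m _ => (h.pow_right m).smul_right _

lemma Ex_move (p : ℕ) (T X Y : B) (h : X * T = T * Y) : Ex p X * T = T * Ex p Y := by
  have hpow : ∀ i : ℕ, X ^ i * T = T * Y ^ i := by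
    intro i
    induction i with
    | zero => simp
    | succ i ih => rw [pow_succ, mul_assoc, h, ← mul_assoc, ih, mul_assoc, pow_succ]
  unfold Ex
  rw [sum_mul, mul_sum]
  refine sum_congr rfl fun m _ => ?_
  rw [smul_mul_assoc, hpow, mul_smul_comm]

lemma map_Th {C : Type*} [Semiring C] [Algebra ℂ C] (p : ℕ) (f : B →ₐ[ℂ] C) (x y : B) :
    f (Th p x y) = Th p (f x) (f y) := by
  simp only [Th, map_smul, map_sum, map_mul, map_pow]

lemma map_Ex {C : Type*} [Semiring C] [Algebra ℂ C] (p : ℕ) (f : B →ₐ[ℂ] C) (x : B) :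
    f (Ex p x) = Ex p (f x) := by
  simp only [Ex, map_smul, map_sum, map_pow]

/-- abstract hexagon -/
lemma hexagon (p : ℕ) (hp : 2 ≤ p) (T T' X Y Z : B)
    (hZ : Z * T' = T' * Y)
    (h : X * Y = ((qq p)⁻¹ ^ 2) • (Y * X))
    (h0 : ∀ i j : ℕ, p ≤ i + j → Y ^ i * X ^ j = 0) :
    T * T' * Ex p (X + Y) = (T * Ex p Z) * (T' * Ex p X) := by
  rw [Ex_add p hp X Y h h0]
  have := Ex_move p T' Z Y hZ
  calc T * T' * (Ex p Y * Ex p X) = T * (T' * Ex p Y) * Ex p X := by simp only [mul_assoc]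
    _ = _ := by rw [← this]; simp only [mul_assoc]

end general

section D

lemma De_pow (p : ℕ) : De p ^ p = 0 := by
  have := RingQuot.mkAlgHom_rel ℂ (DRel.epow (p := p))
  simpa [De] using this

lemma Dphi_pow (p : ℕ) : Dphi p ^ p = 0 := by
  have := RingQuot.mkAlgHom_rel ℂ (DRel.phipow (p := p))
  simpa [Dphi] using this

lemma Dk_pow (p : ℕ) : Dk p ^ (4 * p) = 1 := by
  have := RingQuot.mkAlgHom_rel ℂ (DRel.kpow (p := p))
  simpa [Dk] using this

lemma Dk_kinv (p : ℕ) : Dk p * Dkinv p = 1 := by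
  have := RingQuot.mkAlgHom_rel ℂ (DRel.kkinv (p := p))
  simpa [Dk, Dkinv] using this

lemma Dkinv_k (p : ℕ) : Dkinv p * Dk p = 1 := by
  have := RingQuot.mkAlgHom_rel ℂ (DRel.kinvk (p := p))
  simpa [Dk, Dkinv] using this

lemma Dk_e (p : ℕ) : Dk p * De p = qq p • (De p * Dk p) := by
  have := RingQuot.mkAlgHom_rel ℂ (DRel.ke (p := p))
  have h : Dk p * De p * Dkinv p = qq p • De p := by
    simpa [Dk, Dkinv, De] using this
  rw [← smul_mul_assoc, ← h, mul_assoc, Dkinv_k, mul_one]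

lemma Dk_phi (p : ℕ) : Dk p * Dphi p = (qq p)⁻¹ • (Dphi p * Dk p) := by
  have := RingQuot.mkAlgHom_rel ℂ (DRel.kphi (p := p))
  have h : Dk p * Dphi p * Dkinv p = (qq p)⁻¹ • Dphi p := by
    simpa [Dk, Dkinv, Dphi] using this
  rw [← smul_mul_assoc, ← h, mul_assoc, Dkinv_k, mul_one]

lemma De_phi (p : ℕ) : De p * Dphi p - Dphi p * De p =
    (qq p - (qq p)⁻¹)⁻¹ • (Dk p ^ 2 - Dkinv p ^ 2) := by
  have := RingQuot.mkAlgHom_rel ℂ (DRel.ephi (p := p))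
  simpa only [De, Dphi, Dk, Dkinv, map_sub, map_mul, map_smul, map_pow] using this

lemma Dk2_kinv2 (p : ℕ) : Dk p ^ 2 * Dkinv p ^ 2 = 1 := by
  have h : Commute (Dk p) (Dkinv p) := (Dk_kinv p).trans (Dkinv_k p).symm
  rw [← h.mul_pow, Dk_kinv, one_pow]

lemma Dkinv2_k2 (p : ℕ) : Dkinv p ^ 2 * Dk p ^ 2 = 1 := by
  have h : Commute (Dkinv p) (Dk p) := (Dkinv_k p).trans (Dk_kinv p).symm
  rw [← h.mul_pow, Dkinv_k, one_pow]

lemma Dk_pow_sub (p : ℕ) (hp : 2 ≤ p) : Dk p ^ (4 * p - 2) = Dkinv p ^ 2 := by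
  have h : Dk p ^ (4 * p - 2) * Dk p ^ 2 = 1 := by
    rw [← pow_add, Nat.sub_add_cancel (by omega), Dk_pow]
  calc Dk p ^ (4 * p - 2) = Dk p ^ (4 * p - 2) * (Dk p ^ 2 * Dkinv p ^ 2) := by
        rw [Dk2_kinv2, mul_one]
    _ = _ := by rw [← mul_assoc, h, one_mul]

lemma qh_pow_sub (p : ℕ) (hp : 2 ≤ p) : qh p ^ (4 * p - 2) = (qq p)⁻¹ := by
  rw [qq_eq p hp]
  apply eq_inv_of_mul_eq_one_left
  rw [← pow_add, Nat.sub_add_cancel (by omega), (qh_prim p hp).pow_eq_one]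

lemma Dk2_e (p : ℕ) : Dk p ^ 2 * De p = (qq p ^ 2) • (De p * Dk p ^ 2) := by
  rw [pow_two, mul_assoc, Dk_e, mul_smul_comm, ← mul_assoc, Dk_e, smul_mul_assoc, smul_smul,
    pow_two, mul_assoc]

lemma Dk2_phi (p : ℕ) : Dk p ^ 2 * Dphi p = ((qq p)⁻¹ ^ 2) • (Dphi p * Dk p ^ 2) := by
  rw [pow_two, mul_assoc, Dk_phi, mul_smul_comm, ← mul_assoc, Dk_phi, smul_mul_assoc, smul_smul,
    pow_two, mul_assoc]

lemma De_k2 (p : ℕ) : De p * Dk p ^ 2 = ((qq p)⁻¹ ^ 2) • (Dk p ^ 2 * De p) := by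
  rw [Dk2_e, smul_smul, ← mul_pow, inv_mul_cancel₀ (qq_ne p), one_pow, one_smul]

lemma Dkinv2_e (p : ℕ) : Dkinv p ^ 2 * De p = ((qq p)⁻¹ ^ 2) • (De p * Dkinv p ^ 2) := by
  calc Dkinv p ^ 2 * De p = Dkinv p ^ 2 * (De p * Dk p ^ 2) * Dkinv p ^ 2 := by
        rw [mul_assoc, mul_assoc, Dk2_kinv2, mul_one]
    _ = _ := by
      rw [De_k2, mul_smul_comm, smul_mul_assoc, ← mul_assoc, Dkinv2_k2, one_mul]

lemma Dphi_kinv2 (p : ℕ) : Dphi p * Dkinv p ^ 2 = ((qq p)⁻¹ ^ 2) • (Dkinv p ^ 2 * Dphi p) := by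
  calc Dphi p * Dkinv p ^ 2 = Dkinv p ^ 2 * (Dk p ^ 2 * Dphi p) * Dkinv p ^ 2 := by
        rw [← mul_assoc, Dkinv2_k2, one_mul]
    _ = _ := by
      rw [Dk2_phi, mul_smul_comm, smul_mul_assoc, mul_assoc, mul_assoc, Dk2_kinv2, mul_one]

lemma Dk_pow_pow (p : ℕ) (X : Dq p) (c : ℂ) (h : Dk p * X = c • (X * Dk p)) (n m : ℕ) :
    Dk p ^ n * X ^ m = c ^ (n * m) • (X ^ m * Dk p ^ n) := by
  have h1 : ∀ n : ℕ, Dk p ^ n * X = c ^ n • (X * Dk p ^ n) := by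
    intro n
    induction n with
    | zero => simp
    | succ n ih =>
      rw [pow_succ (Dk p), mul_assoc, h, mul_smul_comm, ← mul_assoc, ih, smul_mul_assoc,
        smul_smul, mul_assoc, pow_succ', ← pow_succ]
  induction m with
  | zero => simp
  | succ m ih =>
    rw [pow_succ X, ← mul_assoc, ih, smul_mul_assoc, mul_assoc, h1, mul_smul_comm, smul_smul,
      ← pow_add, mul_assoc, Nat.mul_succ]

lemma Rmat_eq (p : ℕ) (hp : 2 ≤ p) :
    Rmat p = Th p (Dk p ⊗ₜ[ℂ] (1 : Dq p)) ((1 : Dq p) ⊗ₜ[ℂ] Dk p) *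
      Ex p (De p ⊗ₜ[ℂ] Dphi p) := by
  have hz := qh_ne p
  unfold Rmat Th Ex
  rw [smul_mul_assoc]
  congr 1
  rw [mul_sum]
  refine sum_congr rfl fun m _ => ?_
  rw [sum_mul]
  refine sum_congr rfl fun n _ => ?_
  rw [sum_mul]
  refine sum_congr rfl fun j _ => ?_
  simp only [Algebra.TensorProduct.tmul_pow, Algebra.TensorProduct.tmul_mul_tmul, one_pow,
    one_mul, mul_one, smul_mul_assoc, mul_smul_comm]
  rw [Dk_pow_pow p _ _ (Dk_e p), Dk_pow_pow p _ _ (Dk_phi p)]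
  rw [TensorProduct.smul_tmul_smul, smul_smul, smul_smul]
  congr 1
  unfold aco
  rw [qq_eq p hp, inv_pow, ← pow_mul, ← pow_mul]
  rw [mul_assoc (_ / _)]
  rw [show ((m : ℤ) * ((m : ℤ) - 1) + 2 * (m : ℤ) * ((n : ℤ) - (j : ℤ))
            - (n : ℤ) * (j : ℤ)) = -((n : ℤ) * (j : ℤ)) + ((m : ℤ) * ((m : ℤ) - 1)) +
    (((2 * (n * m) : ℕ) : ℤ) + -((2 * (j * m) : ℕ) : ℤ)) by push_cast; ring]
  rw [zpow_add₀ hz, zpow_add₀ hz, zpow_add₀ hz, zpow_neg _ ((2 * (j * m) : ℕ) : ℤ),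
    zpow_natCast, zpow_natCast]
  ring

lemma map_Rmat (p : ℕ) (hp : 2 ≤ p) {C : Type*} [Semiring C] [Algebra ℂ C]
    (f : Dq p ⊗[ℂ] Dq p →ₐ[ℂ] C) :
    f (Rmat p) = Th p (f (Dk p ⊗ₜ[ℂ] (1 : Dq p))) (f ((1 : Dq p) ⊗ₜ[ℂ] Dk p)) *
      Ex p (f (De p ⊗ₜ[ℂ] Dphi p)) := by
  have h1 := map_Th p f (Dk p ⊗ₜ[ℂ] (1 : Dq p)) ((1 : Dq p) ⊗ₜ[ℂ] Dk p)
  have h2 := map_Ex p f (De p ⊗ₜ[ℂ] Dphi p)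
  rw [Rmat_eq p hp, map_mul]
  rw [h1, h2]

lemma Rmat_unit (p : ℕ) (hp : 2 ≤ p) : IsUnit (Rmat p) := by
  rw [Rmat_eq p hp]
  refine IsUnit.mul ?_ ?_
  · refine Th_unit p hp _ (Dkinv p ⊗ₜ[ℂ] (1 : Dq p)) _ ?_ ?_ ?_ ?_ ?_
    · simp [Dk_pow, Algebra.TensorProduct.one_def]
    · simp [Dk_kinv, Algebra.TensorProduct.one_def]
    · simp [Dkinv_k, Algebra.TensorProduct.one_def]
    · simp [Commute, SemiconjBy]
    · simp [Commute, SemiconjBy]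
  · apply Ex_unit (B := Dq p ⊗[ℂ] Dq p) p hp
    simp [De_pow]

end D

section final

lemma Rmat_e (p : ℕ) (hp : 2 ≤ p) :
    Rmat p * ((1 : Dq p) ⊗ₜ[ℂ] De p + De p ⊗ₜ[ℂ] (Dk p ^ 2)) =
      (De p ⊗ₜ[ℂ] (1 : Dq p) + (Dk p ^ 2) ⊗ₜ[ℂ] De p) * Rmat p := by
  rw [Rmat_eq p hp]
  have hxy : Commute (Dk p ⊗ₜ[ℂ] (1 : Dq p)) ((1 : Dq p) ⊗ₜ[ℂ] Dk p) := by
    simp [Commute, SemiconjBy]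
  have hx : (Dk p ⊗ₜ[ℂ] (1 : Dq p)) ^ (4 * p) = 1 := by
    simp [Dk_pow, Algebra.TensorProduct.one_def]
  have hy : ((1 : Dq p) ⊗ₜ[ℂ] Dk p) ^ (4 * p) = 1 := by
    simp [Dk_pow, Algebra.TensorProduct.one_def]
  have hpp : p - 1 + 1 = p := by omega
  have hQ := Ex_comm p hp ((1 : Dq p) ⊗ₜ[ℂ] De p) (De p ⊗ₜ[ℂ] Dphi p)
    (De p ⊗ₜ[ℂ] (Dk p ^ 2)) (De p ⊗ₜ[ℂ] (Dkinv p ^ 2))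
    (by
      simp only [Algebra.TensorProduct.tmul_mul_tmul, one_mul, mul_one]
      rw [← TensorProduct.tmul_sub, De_phi, TensorProduct.tmul_smul, TensorProduct.tmul_sub])
    (by
      simp only [Algebra.TensorProduct.tmul_mul_tmul]
      rw [Dk2_phi, TensorProduct.tmul_smul])
    (by
      simp only [Algebra.TensorProduct.tmul_mul_tmul]
      rw [Dphi_kinv2, TensorProduct.tmul_smul])
    (by
      simp only [Algebra.TensorProduct.tmul_mul_tmul, Algebra.TensorProduct.tmul_pow]
      rw [← pow_succ, hpp, De_pow, TensorProduct.zero_tmul])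
    (by
      simp only [Algebra.TensorProduct.tmul_mul_tmul, Algebra.TensorProduct.tmul_pow]
      rw [← pow_succ', hpp, De_pow, TensorProduct.zero_tmul])
  have hV := Th_move p hp _ _ (De p ⊗ₜ[ℂ] (Dkinv p ^ 2)) 2 hy hxy
    (by
      simp only [Algebra.TensorProduct.tmul_mul_tmul, one_mul, mul_one]
      rw [Dk_e, ← qq_eq p hp, TensorProduct.smul_tmul'])
    (by
      simp only [Commute, SemiconjBy, Algebra.TensorProduct.tmul_mul_tmul, one_mul, mul_one]
      rw [← Dk_pow_sub p hp, ← pow_succ, ← pow_succ'])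
  have hW := Th_move_right p hp _ _ ((1 : Dq p) ⊗ₜ[ℂ] De p) 2 hx hxy
    (by
      simp only [Algebra.TensorProduct.tmul_mul_tmul, one_mul, mul_one]
      rw [Dk_e, ← qq_eq p hp, TensorProduct.tmul_smul])
    (by simp [Commute, SemiconjBy])
  simp only [Algebra.TensorProduct.tmul_mul_tmul, Algebra.TensorProduct.tmul_pow, one_pow,
    one_mul, mul_one, Dkinv2_k2] at hV hW
  rw [mul_assoc, hQ, ← mul_assoc, mul_add, hV, hW, ← add_mul, mul_assoc]

lemma neg_aux {A : Type*} [Ring A] [Algebra ℂ A] (a b x y : A) (c : ℂ)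
    (h : a - b = c • (x - y)) : b - a = c • (y - x) := by
  rw [← neg_sub a b, h, ← smul_neg, neg_sub]

lemma Dphi_e (p : ℕ) : Dphi p * De p - De p * Dphi p =
    (qq p - (qq p)⁻¹)⁻¹ • (Dkinv p ^ 2 - Dk p ^ 2) :=
  neg_aux _ _ _ _ _ (De_phi p)

lemma Rmat_phi (p : ℕ) (hp : 2 ≤ p) :
    Rmat p * ((Dkinv p ^ 2) ⊗ₜ[ℂ] Dphi p + Dphi p ⊗ₜ[ℂ] (1 : Dq p)) =
      (Dphi p ⊗ₜ[ℂ] (Dkinv p ^ 2) + (1 : Dq p) ⊗ₜ[ℂ] Dphi p) * Rmat p := by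
  rw [Rmat_eq p hp]
  have hxy : Commute (Dk p ⊗ₜ[ℂ] (1 : Dq p)) ((1 : Dq p) ⊗ₜ[ℂ] Dk p) := by
    simp [Commute, SemiconjBy]
  have hx : (Dk p ⊗ₜ[ℂ] (1 : Dq p)) ^ (4 * p) = 1 := by
    simp [Dk_pow, Algebra.TensorProduct.one_def]
  have hy : ((1 : Dq p) ⊗ₜ[ℂ] Dk p) ^ (4 * p) = 1 := by
    simp [Dk_pow, Algebra.TensorProduct.one_def]
  have hpp : p - 1 + 1 = p := by omega
  have hQ := Ex_comm p hp (Dphi p ⊗ₜ[ℂ] (1 : Dq p)) (De p ⊗ₜ[ℂ] Dphi p)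
    ((Dkinv p ^ 2) ⊗ₜ[ℂ] Dphi p) ((Dk p ^ 2) ⊗ₜ[ℂ] Dphi p)
    (by
      simp only [Algebra.TensorProduct.tmul_mul_tmul, one_mul, mul_one]
      rw [← TensorProduct.sub_tmul, Dphi_e, ← TensorProduct.smul_tmul', TensorProduct.sub_tmul])
    (by
      simp only [Algebra.TensorProduct.tmul_mul_tmul]
      rw [Dkinv2_e, TensorProduct.smul_tmul'])
    (by
      simp only [Algebra.TensorProduct.tmul_mul_tmul]
      rw [De_k2, TensorProduct.smul_tmul'])
    (by
      simp only [Algebra.TensorProduct.tmul_mul_tmul, Algebra.TensorProduct.tmul_pow]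
      rw [← pow_succ (Dphi p), hpp, Dphi_pow, TensorProduct.tmul_zero])
    (by
      simp only [Algebra.TensorProduct.tmul_mul_tmul, Algebra.TensorProduct.tmul_pow]
      rw [← pow_succ' (Dphi p), hpp, Dphi_pow, TensorProduct.tmul_zero])
  have hV := Th_move_right p hp _ _ ((Dk p ^ 2) ⊗ₜ[ℂ] Dphi p) (4 * p - 2) hx hxy
    (by
      simp only [Algebra.TensorProduct.tmul_mul_tmul, one_mul, mul_one]
      rw [Dk_phi, qh_pow_sub p hp, TensorProduct.tmul_smul])
    (by
      simp only [Commute, SemiconjBy, Algebra.TensorProduct.tmul_mul_tmul, one_mul, mul_one]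
      rw [← pow_succ, ← pow_succ'])
  have hW := Th_move p hp _ _ (Dphi p ⊗ₜ[ℂ] (1 : Dq p)) (4 * p - 2) hy hxy
    (by
      simp only [Algebra.TensorProduct.tmul_mul_tmul, one_mul, mul_one]
      rw [Dk_phi, qh_pow_sub p hp, TensorProduct.smul_tmul'])
    (by simp [Commute, SemiconjBy])
  simp only [Algebra.TensorProduct.tmul_mul_tmul, Algebra.TensorProduct.tmul_pow, one_pow,
    one_mul, mul_one, Dk_pow_sub p hp, Dk2_kinv2] at hV hW
  rw [mul_assoc, add_comm ((Dkinv p ^ 2) ⊗ₜ[ℂ] Dphi p), hQ, ← mul_assoc, mul_add, hV, hW,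
    ← add_mul, mul_assoc, add_comm ((1 : Dq p) ⊗ₜ[ℂ] Dphi p)]

lemma Rmat_k (p : ℕ) (hp : 2 ≤ p) : Commute (Dk p ⊗ₜ[ℂ] Dk p) (Rmat p) := by
  rw [Rmat_eq p hp]
  refine Commute.mul_right (Th_commute p _ _ _ ?_ ?_) (Ex_commute p _ _ ?_)
  · simp [Commute, SemiconjBy]
  · simp [Commute, SemiconjBy]
  · simp only [Commute, SemiconjBy, Algebra.TensorProduct.tmul_mul_tmul]
    rw [Dk_e, Dk_phi, TensorProduct.smul_tmul_smul, mul_inv_cancel₀ (qq_ne p), one_smul]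

lemma Rmat_kinv (p : ℕ) (hp : 2 ≤ p) : Commute (Dkinv p ⊗ₜ[ℂ] Dkinv p) (Rmat p) := by
  have h := (Rmat_k p hp).eq
  have h1 : (Dkinv p ⊗ₜ[ℂ] Dkinv p) * (Dk p ⊗ₜ[ℂ] Dk p) = 1 := by
    simp [Dkinv_k, Algebra.TensorProduct.one_def]
  have h2 : (Dk p ⊗ₜ[ℂ] Dk p) * (Dkinv p ⊗ₜ[ℂ] Dkinv p) = 1 := by
    simp [Dk_kinv, Algebra.TensorProduct.one_def]
  calc (Dkinv p ⊗ₜ[ℂ] Dkinv p) * Rmat p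
      = (Dkinv p ⊗ₜ[ℂ] Dkinv p) * (Rmat p * (Dk p ⊗ₜ[ℂ] Dk p)) * (Dkinv p ⊗ₜ[ℂ] Dkinv p) := by
        rw [mul_assoc, mul_assoc, h2, mul_one]
    _ = _ := by rw [← h, ← mul_assoc, h1, one_mul]

lemma intertwine (p : ℕ) (hp : 2 ≤ p) (Δ : Dq p →ₐ[ℂ] Dq p ⊗[ℂ] Dq p) (hΔ : IsDeltaD p Δ)
    (x : Dq p) :
    Rmat p * Δ x = Algebra.TensorProduct.comm ℂ (Dq p) (Dq p) (Δ x) * Rmat p := by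
  obtain ⟨he, hphi, hk, hkinv⟩ := hΔ
  obtain ⟨y, rfl⟩ := RingQuot.mkAlgHom_surjective ℂ (DRel p) x
  induction y using FreeAlgebra.induction with
  | grade0 r =>
    simp only [AlgHom.commutes, AlgEquiv.commutes]
    exact (Algebra.commutes r (Rmat p)).symm
  | grade1 g =>
    cases g with
    | e =>
      change Rmat p * Δ (De p) = Algebra.TensorProduct.comm ℂ (Dq p) (Dq p) (Δ (De p)) * Rmat p
      rw [he, Rmat_e p hp, map_add, Algebra.TensorProduct.comm_tmul,
        Algebra.TensorProduct.comm_tmul]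
    | phi =>
      change Rmat p * Δ (Dphi p) =
        Algebra.TensorProduct.comm ℂ (Dq p) (Dq p) (Δ (Dphi p)) * Rmat p
      rw [hphi, Rmat_phi p hp, map_add, Algebra.TensorProduct.comm_tmul,
        Algebra.TensorProduct.comm_tmul]
    | k =>
      change Rmat p * Δ (Dk p) = Algebra.TensorProduct.comm ℂ (Dq p) (Dq p) (Δ (Dk p)) * Rmat p
      rw [hk, Algebra.TensorProduct.comm_tmul, (Rmat_k p hp).eq]
    | kinv =>
      change Rmat p * Δ (Dkinv p) =
        Algebra.TensorProduct.comm ℂ (Dq p) (Dq p) (Δ (Dkinv p)) * Rmat p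
      rw [hkinv, Algebra.TensorProduct.comm_tmul, (Rmat_kinv p hp).eq]
  | mul a b ha hb =>
    rw [map_mul, map_mul, map_mul, ← mul_assoc, ha, mul_assoc, hb, mul_assoc]
  | add a b ha hb =>
    rw [map_add, map_add, map_add, mul_add, add_mul, ha, hb]

lemma hex1_gen (p : ℕ) (hp : 2 ≤ p) {A : Type*} [Semiring A] [Algebra ℂ A]
    (Δ i1 i2 : Dq p →ₐ[ℂ] A) (hcomm : ∀ x y, Commute (i1 x) (i2 y))
    (he : Δ (De p) = i2 (De p) + i1 (De p) * i2 (Dk p) ^ 2)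
    (hk : Δ (Dk p) = i1 (Dk p) * i2 (Dk p)) :
    Algebra.TensorProduct.map Δ (AlgHom.id ℂ (Dq p)) (Rmat p) =
      Algebra.TensorProduct.map i1 (AlgHom.id ℂ (Dq p)) (Rmat p) *
      Algebra.TensorProduct.map i2 (AlgHom.id ℂ (Dq p)) (Rmat p) := by
  have h1 := map_Rmat p hp (C := A ⊗[ℂ] Dq p)
    (Algebra.TensorProduct.map Δ (AlgHom.id ℂ (Dq p)))
  have h2 := map_Rmat p hp (C := A ⊗[ℂ] Dq p)
    (Algebra.TensorProduct.map i1 (AlgHom.id ℂ (Dq p)))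
  have h3 := map_Rmat p hp (C := A ⊗[ℂ] Dq p)
    (Algebra.TensorProduct.map i2 (AlgHom.id ℂ (Dq p)))
  rw [h1, h2, h3]
  simp only [Algebra.TensorProduct.map_tmul, map_one, he, hk, AlgHom.coe_id, id_eq]
  have hkk : (i1 (Dk p) * i2 (Dk p)) ⊗ₜ[ℂ] (1 : Dq p) =
      (i1 (Dk p) ⊗ₜ[ℂ] (1 : Dq p)) * (i2 (Dk p) ⊗ₜ[ℂ] (1 : Dq p)) := by
    simp
  have hx2 : (i2 (Dk p) ⊗ₜ[ℂ] (1 : Dq p)) ^ (4 * p) = 1 := by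
    rw [Algebra.TensorProduct.tmul_pow, one_pow, ← map_pow, Dk_pow, map_one]; rfl
  have hx3 : ((1 : A) ⊗ₜ[ℂ] Dk p) ^ (4 * p) = 1 := by
    rw [Algebra.TensorProduct.tmul_pow, one_pow, Dk_pow]; rfl
  have hc := (hcomm (Dk p) (Dk p)).eq
  have hc2 := (hcomm (De p) (Dk p)).eq
  rw [hkk, TensorProduct.add_tmul, Th_mul p hp _ _ _ hx3 (by simp [Commute, SemiconjBy, hc])
    (by simp [Commute, SemiconjBy])]
  apply hexagon p hp
  · have h := Th_move_right p hp (i2 (Dk p) ⊗ₜ[ℂ] (1 : Dq p))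
      ((1 : A) ⊗ₜ[ℂ] Dk p) ((i1 (De p) * i2 (Dk p) ^ 2) ⊗ₜ[ℂ] Dphi p) (4 * p - 2) hx2
      (by simp [Commute, SemiconjBy])
      (by
        simp only [Algebra.TensorProduct.tmul_mul_tmul, one_mul, mul_one]
        rw [Dk_phi, qh_pow_sub p hp, TensorProduct.tmul_smul])
      (by
        simp only [Commute, SemiconjBy, Algebra.TensorProduct.tmul_mul_tmul, one_mul, mul_one]
        rw [mul_assoc, ← mul_assoc (i2 (Dk p)), ← hc2, mul_assoc, ← pow_succ, ← pow_succ'])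
    rw [h]
    simp only [Algebra.TensorProduct.tmul_mul_tmul, Algebra.TensorProduct.tmul_pow, one_pow,
      mul_one, mul_assoc]
    rw [← map_pow, ← map_pow, ← map_mul i2, Dk_pow_sub p hp, Dk2_kinv2, map_one, mul_one]
  · have hc3 := (hcomm (De p) (De p)).eq
    simp only [Algebra.TensorProduct.tmul_mul_tmul]
    rw [← mul_assoc, ← hc3, mul_assoc, mul_assoc, ← map_pow, ← map_mul, De_k2, map_smul, map_mul,
      mul_smul_comm, TensorProduct.smul_tmul']
  · intro i j hij
    simp only [Algebra.TensorProduct.tmul_mul_tmul, Algebra.TensorProduct.tmul_pow]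
    rw [← pow_add, pow_eq_zero_of_le hij (Dphi_pow p), TensorProduct.tmul_zero]

lemma hex1 (p : ℕ) (hp : 2 ≤ p) (Δ : Dq p →ₐ[ℂ] Dq p ⊗[ℂ] Dq p) (hΔ : IsDeltaD p Δ) :
    Algebra.TensorProduct.map Δ (AlgHom.id ℂ (Dq p)) (Rmat p) =
      Algebra.TensorProduct.map (Algebra.TensorProduct.includeLeft : Dq p →ₐ[ℂ] Dq p ⊗[ℂ] Dq p)
        (AlgHom.id ℂ (Dq p)) (Rmat p) *
      Algebra.TensorProduct.map (Algebra.TensorProduct.includeRight : Dq p →ₐ[ℂ] Dq p ⊗[ℂ] Dq p)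
        (AlgHom.id ℂ (Dq p)) (Rmat p) := by
  obtain ⟨he, hphi, hk, hkinv⟩ := hΔ
  exact hex1_gen p hp (A := Dq p ⊗[ℂ] Dq p) Δ Algebra.TensorProduct.includeLeft
    Algebra.TensorProduct.includeRight (by intro x y; simp [Commute, SemiconjBy])
    (by rw [he]; simp [Algebra.TensorProduct.tmul_pow]) (by rw [hk]; simp)

lemma hex2 (p : ℕ) (hp : 2 ≤ p) (Δ : Dq p →ₐ[ℂ] Dq p ⊗[ℂ] Dq p) (hΔ : IsDeltaD p Δ) :
    Algebra.TensorProduct.map (AlgHom.id ℂ (Dq p)) Δ (Rmat p) =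
      Algebra.TensorProduct.map (AlgHom.id ℂ (Dq p))
        (Algebra.TensorProduct.includeRight : Dq p →ₐ[ℂ] Dq p ⊗[ℂ] Dq p) (Rmat p) *
      Algebra.TensorProduct.map (AlgHom.id ℂ (Dq p))
        (Algebra.TensorProduct.includeLeft : Dq p →ₐ[ℂ] Dq p ⊗[ℂ] Dq p) (Rmat p) := by
  obtain ⟨he, hphi, hk, hkinv⟩ := hΔ
  have h1 := map_Rmat p hp (C := Dq p ⊗[ℂ] (Dq p ⊗[ℂ] Dq p)) (Algebra.TensorProduct.map (AlgHom.id ℂ (Dq p))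
    Δ)
  have h2 := map_Rmat p hp (C := Dq p ⊗[ℂ] (Dq p ⊗[ℂ] Dq p)) (Algebra.TensorProduct.map (AlgHom.id ℂ (Dq p))
    (Algebra.TensorProduct.includeRight : Dq p →ₐ[ℂ] Dq p ⊗[ℂ] Dq p))
  have h3 := map_Rmat p hp (C := Dq p ⊗[ℂ] (Dq p ⊗[ℂ] Dq p)) (Algebra.TensorProduct.map (AlgHom.id ℂ (Dq p))
    (Algebra.TensorProduct.includeLeft : Dq p →ₐ[ℂ] Dq p ⊗[ℂ] Dq p))
  rw [h1, h2, h3]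
  simp only [Algebra.TensorProduct.map_tmul, map_one, hphi, hk, AlgHom.coe_id, id_eq,
    Algebra.TensorProduct.includeLeft_apply, Algebra.TensorProduct.includeRight_apply]
  have hkk : (1 : Dq p) ⊗ₜ[ℂ] (Dk p ⊗ₜ[ℂ] Dk p) =
      ((1 : Dq p) ⊗ₜ[ℂ] ((1 : Dq p) ⊗ₜ[ℂ] Dk p)) *
        ((1 : Dq p) ⊗ₜ[ℂ] (Dk p ⊗ₜ[ℂ] (1 : Dq p))) := by
    simp
  have hx1 : (Dk p ⊗ₜ[ℂ] (1 : Dq p ⊗[ℂ] Dq p)) ^ (4 * p) = 1 := by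
    simp only [Algebra.TensorProduct.tmul_pow, one_pow, Dk_pow]; rfl
  have hx2 : ((1 : Dq p) ⊗ₜ[ℂ] (Dk p ⊗ₜ[ℂ] (1 : Dq p))) ^ (4 * p) = 1 := by
    simp only [Algebra.TensorProduct.tmul_pow, one_pow, Dk_pow]; rfl
  rw [hkk, add_comm ((Dkinv p ^ 2) ⊗ₜ[ℂ] Dphi p), TensorProduct.tmul_add,
    Th_mul_right p hp _ _ _ hx1 (by simp [Commute, SemiconjBy])
    (by simp [Commute, SemiconjBy]) (by simp [Commute, SemiconjBy])]
  apply hexagon p hp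
  · have h := Th_move p hp (Dk p ⊗ₜ[ℂ] (1 : Dq p ⊗[ℂ] Dq p))
      ((1 : Dq p) ⊗ₜ[ℂ] (Dk p ⊗ₜ[ℂ] (1 : Dq p))) (De p ⊗ₜ[ℂ] ((Dkinv p ^ 2) ⊗ₜ[ℂ] Dphi p)) 2 hx2
      (by simp [Commute, SemiconjBy])
      (by
        simp only [Algebra.TensorProduct.tmul_mul_tmul, one_mul, mul_one]
        rw [Dk_e, ← qq_eq p hp, TensorProduct.smul_tmul'])
      (by
        simp only [Commute, SemiconjBy, Algebra.TensorProduct.tmul_mul_tmul, one_mul, mul_one]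
        rw [← Dk_pow_sub p hp, ← pow_succ, ← pow_succ'])
    rw [h]
    simp only [Algebra.TensorProduct.tmul_mul_tmul, Algebra.TensorProduct.tmul_pow, one_pow,
      mul_one, Dkinv2_k2]
  · simp only [Algebra.TensorProduct.tmul_mul_tmul, one_mul, mul_one]
    rw [Dphi_kinv2, ← TensorProduct.smul_tmul', TensorProduct.tmul_smul]
  · intro i j hij
    simp only [Algebra.TensorProduct.tmul_mul_tmul, Algebra.TensorProduct.tmul_pow]
    rw [← pow_add, pow_eq_zero_of_le hij (De_pow p), TensorProduct.zero_tmul]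

end final

end LogHennings


open LogHennings in
/-- `R` is a universal `R`-matrix for `D`: it is invertible, conjugates the
comultiplication to its opposite, and satisfies the two hexagon identities. -/
theorem R_is_universal_R_matrix (p : ℕ) (hp : 2 ≤ p) :
    IsUnit (Rmat p) ∧
    ∀ Δ : Dq p →ₐ[ℂ] Dq p ⊗[ℂ] Dq p, IsDeltaD p Δ →
      (∀ x : Dq p,
        Rmat p * Δ x = TensorProduct.comm ℂ (Dq p) (Dq p) (Δ x) * Rmat p) ∧
      TensorProduct.map Δ.toLinearMap LinearMap.id (Rmat p) =
        TensorProduct.map (e1 p) LinearMap.id (Rmat p) *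
          TensorProduct.map (e2 p) LinearMap.id (Rmat p) ∧
      TensorProduct.map LinearMap.id Δ.toLinearMap (Rmat p) =
        TensorProduct.map LinearMap.id (e2 p) (Rmat p) *
          TensorProduct.map LinearMap.id (e1 p) (Rmat p) := by
  refine ⟨Rmat_unit p hp, fun Δ hΔ => ⟨fun x => ?_, ?_, ?_⟩⟩
  · exact intertwine p hp Δ hΔ x
  · exact hex1 p hp Δ hΔ
  · exact hex2 p hp Δ hΔ
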